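/- If a binary linear code C (parity-check matrix H with no all-zero column) is 3-combinable, then C is also 4-combinable. -/

import Mathlib

open Matrix

/-- Hamming weight of a row vector over GF(2). -/
def hammingWt {e : ℕ} (v : Fin e → ZMod 2) : ℕ :=
  (Finset.univ.filter fun j => v j ≠ 0).card

/-- `H` has no all-zero column. -/
def NoZeroColumn {m n : ℕ} (H : Matrix (Fin m) (Fin n) (ZMod 2)) : Prop :=
  ∀ j, ∃ i, H i j ≠ 0

/-- The code with parity-check matrix `H` is `ε`-combinable: every submatrix of
`H_E` (whose rows are all nonzero GF(2) linear combinations `vecMul u H`, `u ≠ 0`,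
of the rows of `H`) formed by selecting `ε` columns contains a row of Hamming
weight 1 or 2. -/
def Combinable (m n ε : ℕ) (H : Matrix (Fin m) (Fin n) (ZMod 2)) : Prop :=
  ∀ s : Fin ε → Fin n, Function.Injective s →
    ∃ u : Fin m → ZMod 2, u ≠ 0 ∧
      (hammingWt (fun j => (vecMul u H) (s j)) = 1 ∨
       hammingWt (fun j => (vecMul u H) (s j)) = 2)

instance decWt {e : ℕ} (v : Fin e → ZMod 2) (k : ℕ) : Decidable (hammingWt v = k) :=
  inferInstanceAs (Decidable (_ = _))

set_option maxRecDepth 100000 in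
lemma aux1 : ∀ a : Fin 4 → ZMod 2, ¬ (hammingWt a = 1 ∨ hammingWt a = 2) →
    (hammingWt (fun j : Fin 3 => a (Fin.succ j)) = 1 ∨
      hammingWt (fun j : Fin 3 => a (Fin.succ j)) = 2) →
    ∃ k, a k = 0 ∧ hammingWt a = 3 := by
  decide

set_option maxRecDepth 100000 in
set_option maxHeartbeats 4000000 in
lemma aux2 : ∀ a : Fin 4 → ZMod 2, hammingWt a = 3 → ∀ k, a k = 0 →
    ∀ b : Fin 4 → ZMod 2, ¬ (hammingWt b = 1 ∨ hammingWt b = 2) →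
    (hammingWt (fun j : Fin 3 => b (k.succAbove j)) = 1 ∨
      hammingWt (fun j : Fin 3 => b (k.succAbove j)) = 2) →
    hammingWt (fun j => a j + b j) = 2 := by
  decide

/-- If `C` (no all-zero column) is 3-combinable, then it is also 4-combinable. -/
theorem stmt_7 (m n : ℕ) (H : Matrix (Fin m) (Fin n) (ZMod 2))
    (hcol : NoZeroColumn H) (hcomb : Combinable m n 3 H) :
    Combinable m n 4 H := by
  intro s hs
  by_contra hno
  have key : ∀ u : Fin m → ZMod 2, ¬ (hammingWt (fun j => (vecMul u H) (s j)) = 1 ∨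
       hammingWt (fun j => (vecMul u H) (s j)) = 2) := by
    intro u hu
    by_cases h0 : u = 0
    · subst h0
      simp [hammingWt] at hu
    · exact hno ⟨u, h0, hu⟩
  obtain ⟨u, -, hu⟩ := hcomb (fun j => s (Fin.succ j)) (hs.comp (Fin.succ_injective 3))
  obtain ⟨k, hk, hw⟩ := aux1 (fun j => (vecMul u H) (s j)) (key u) hu
  obtain ⟨v, -, hv⟩ := hcomb (fun j => s (k.succAbove j))
    (hs.comp Fin.succAbove_right_injective)
  have h := aux2 _ hw k hk (fun j => (vecMul v H) (s j)) (key v) hv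
  apply key (u + v)
  right
  rw [add_vecMul]
  exact h
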